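/- arXiv:2011.05221 — 2 statements merged into one kernel-verified Lean document; each statement's English description precedes it below -/
import Mathlib

section
/- Let v, w ∈ W^P with w the minimal length representative of v s_α W_P for some positive root α ∈ R^+ ∖ R_P^+ (so v and w are joined by an edge of the moment graph of IG(k,2n+2)). Then: (1) the degree of this edge equals 1 if α ∈ R_1^+ and equals 2 if α ∈ R_2^+; (2) if α ∈ R_1^+ then φ(w) ≤ φ(v) + 1; (3) if α ∈ R_2^+ then φ(w) ≤ φ(v) + 2. -/
/-!
Common framework: the Weyl group of type `C_{m+1}` realized as signed permutations
of `Fin (2*m+2)` (values 0-indexed: the paper's 1-indexed value `a ∈ {1, …, 2m+2}`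
corresponds to `a-1`, and the paper's `bar a = 2m+3-a` corresponds to `2m+2-a`).
For the odd symplectic Grassmannian `IG(k, 2n+1)` one takes `m = n`;
the smaller group `W_{2n}` of type `C_n` corresponds to `m = n-1`.
-/

namespace OddSymplectic

open Equiv

noncomputable section

/-- The element of `Fin (2*m+2)` with (0-indexed) value `i`. -/
def fn (m i : ℕ) : Fin (2*m+2) := ⟨i % (2*m+2), Nat.mod_lt _ (by omega)⟩

/-- The bar involution on values. -/
def bar (m : ℕ) (j : Fin (2*m+2)) : Fin (2*m+2) := ⟨2*m+1 - (j:ℕ), by omega⟩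

def barPerm (m : ℕ) : Equiv.Perm (Fin (2*m+2)) :=
  Function.Involutive.toPerm (bar m) (fun j => by
    have hj := j.isLt
    apply Fin.ext
    simp [bar]
    omega)

/-- The Weyl group of type `C_{m+1}`: the permutations of `Fin (2*m+2)` commuting with
the bar involution (signed permutations). -/
def Weyl (m : ℕ) : Subgroup (Equiv.Perm (Fin (2*m+2))) :=
  Subgroup.centralizer {barPerm m}

/-- The simple reflection `s_i`, `1 ≤ i ≤ m+1`. -/
def sRefl (m i : ℕ) : Equiv.Perm (Fin (2*m+2)) :=
  if i ≤ m then
    Equiv.swap (fn m (i-1)) (fn m i) * Equiv.swap (fn m (2*m+2-i)) (fn m (2*m+1-i))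
  else
    Equiv.swap (fn m m) (fn m (m+1))

/-- Coxeter length: the minimal length of an expression as a product of simple reflections. -/
def len (m : ℕ) (w : Equiv.Perm (Fin (2*m+2))) : ℕ :=
  sInf {r | ∃ l : List ℕ, l.length = r ∧ (∀ i ∈ l, 1 ≤ i ∧ i ≤ m+1) ∧
    (l.map (sRefl m)).prod = w}

/-- The set of reflections. -/
def reflections (m : ℕ) : Set (Equiv.Perm (Fin (2*m+2))) :=
  {t | ∃ u ∈ Weyl m, ∃ i, 1 ≤ i ∧ i ≤ m+1 ∧ t = u * sRefl m i * u⁻¹}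

/-- The Bruhat order. -/
def bruhatLE (m : ℕ) (u w : Equiv.Perm (Fin (2*m+2))) : Prop :=
  Relation.ReflTransGen (fun a b => ∃ t ∈ reflections m, b = a * t ∧ len m a < len m b) u w

/-- The parabolic subgroup `W_P` generated by the simple reflections `s_i`, `i ≠ kk`. -/
def WP (m kk : ℕ) : Subgroup (Equiv.Perm (Fin (2*m+2))) :=
  Subgroup.closure {x | ∃ i, 1 ≤ i ∧ i ≤ m+1 ∧ i ≠ kk ∧ x = sRefl m i}

/-- `x W_P = y W_P`. -/
def cosetEq (m kk : ℕ) (x y : Equiv.Perm (Fin (2*m+2))) : Prop := x⁻¹ * y ∈ WP m kk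

/-- `w ∈ W^P`: `w` is a minimal length representative of its coset `w W_P`. -/
def isMinRep (m kk : ℕ) (w : Equiv.Perm (Fin (2*m+2))) : Prop :=
  w ∈ Weyl m ∧ ∀ v ∈ WP m kk, len m w ≤ len m (w * v)

/-- `w ∈ W^{odd}`: `w(j) ≠ bar 1` for all `1 ≤ j ≤ m+1` (1-indexed positions). -/
def isOdd (m : ℕ) (w : Equiv.Perm (Fin (2*m+2))) : Prop :=
  ∀ j : Fin (2*m+2), (j:ℕ) ≤ m → w j ≠ fn m (2*m+1)

/-- `w ∈ W°`: odd symplectic permutations with `w(j) ≠ 1` for `1 ≤ j ≤ kk`. -/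
def isOpen (m kk : ℕ) (w : Equiv.Perm (Fin (2*m+2))) : Prop :=
  isOdd m w ∧ ∀ j : Fin (2*m+2), (j:ℕ) < kk → w j ≠ fn m 0

/-- `φ(u)`: the number of barred entries among the first `kk` values of `u`. -/
def phi (m kk : ℕ) (u : Equiv.Perm (Fin (2*m+2))) : ℕ :=
  (Finset.univ.filter (fun j : Fin (2*m+2) => (j:ℕ) < kk ∧ m+1 ≤ ((u j : ℕ)))).card

/-- The set of values of `w` on the first `kk` positions. -/
def valSet (m kk : ℕ) (w : Equiv.Perm (Fin (2*m+2))) : Finset (Fin (2*m+2)) :=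
  (Finset.univ.filter (fun j : Fin (2*m+2) => (j:ℕ) < kk)).image w

/-- The (1-indexed) absolute value `|x|` of a signed entry. -/
def absVal (m : ℕ) (x : Fin (2*m+2)) : ℕ :=
  if (x:ℕ) ≤ m then (x:ℕ)+1 else 2*m+2-(x:ℕ)

/-! ### Hecke products -/

def hStep (m : ℕ) (w : Equiv.Perm (Fin (2*m+2))) (i : ℕ) : Equiv.Perm (Fin (2*m+2)) :=
  if len m w < len m (w * sRefl m i) then w * sRefl m i else w

/-- Hecke product of `w` with the word `l` of simple reflections. -/
def hWord (m : ℕ) (w : Equiv.Perm (Fin (2*m+2))) (l : List ℕ) : Equiv.Perm (Fin (2*m+2)) :=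
  l.foldl (hStep m) w

def hStepK (m kk : ℕ) (w : Equiv.Perm (Fin (2*m+2))) (i : ℕ) : Equiv.Perm (Fin (2*m+2)) :=
  if len m w < len m (w * sRefl m i) ∨ i = kk then w * sRefl m i else w

/-- Modified Hecke product `·_k` of `w` with the word `l`. -/
def hWordK (m kk : ℕ) (w : Equiv.Perm (Fin (2*m+2))) (l : List ℕ) : Equiv.Perm (Fin (2*m+2)) :=
  l.foldl (hStepK m kk) w

/-- The list `[a, a+1, …, b]`. -/
def ascList (a b : ℕ) : List ℕ := List.range' a (b+1-a)

/-- The word `s_1 s_2 ⋯ s_{m+1} ⋯ s_2 s_1` for `O^∘(1)`. -/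
def wordOcirc1 (m : ℕ) : List ℕ := ascList 1 (m+1) ++ (ascList 1 m).reverse

/-- The word `s_1 ⋯ s_{kk-1} s_{kk+1} ⋯ s_{m+1} ⋯ s_2 s_1` for `O_Y(1)`. -/
def wordOY1 (m kk : ℕ) : List ℕ :=
  ascList 1 (kk-1) ++ ascList (kk+1) (m+1) ++ (ascList 1 m).reverse

/-- The word `s_2 ⋯ s_{m+1} ⋯ s_2` for `O_Z(1)`. -/
def wordOZ1 (m : ℕ) : List ℕ := ascList 2 (m+1) ++ (ascList 2 m).reverse

def wordOcirc (m d : ℕ) : List ℕ := (List.replicate d (wordOcirc1 m)).flatten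
def wordOZ (m d : ℕ) : List ℕ := (List.replicate d (wordOZ1 m)).flatten

/-- `w ·_k O^∘(d)`. -/
def mulOcirc (m kk : ℕ) (w : Equiv.Perm (Fin (2*m+2))) (d : ℕ) : Equiv.Perm (Fin (2*m+2)) :=
  hWordK m kk w (wordOcirc m d)

/-- `w · O_Z(d)`. -/
def mulOZ (m : ℕ) (w : Equiv.Perm (Fin (2*m+2))) (d : ℕ) : Equiv.Perm (Fin (2*m+2)) :=
  hWord m w (wordOZ m d)

/-- `w · O_Y(1)`. -/
def mulOY1 (m kk : ℕ) (w : Equiv.Perm (Fin (2*m+2))) : Equiv.Perm (Fin (2*m+2)) :=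
  hWord m w (wordOY1 m kk)

/-- `w · O_Y(d) = (w · O_Y(1)) ·_k O^∘(d-1)`. -/
def mulOY (m kk : ℕ) (w : Equiv.Perm (Fin (2*m+2))) (d : ℕ) : Equiv.Perm (Fin (2*m+2)) :=
  mulOcirc m kk (mulOY1 m kk w) (d-1)

/-! ### Positive roots of type `C_{m+1}` -/

/-- Positive roots of type `C_{m+1}` (1-indexed `i < j ≤ m+1`). -/
inductive PosRoot : Type
  | tm (i j : ℕ)   -- `t_i - t_j`
  | tp (i j : ℕ)   -- `t_i + t_j`
  | lg (i : ℕ)     -- `2 t_i`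

def PosRoot.valid (m : ℕ) : PosRoot → Prop
  | .tm i j => 1 ≤ i ∧ i < j ∧ j ≤ m+1
  | .tp i j => 1 ≤ i ∧ i < j ∧ j ≤ m+1
  | .lg i => 1 ≤ i ∧ i ≤ m+1

/-- The reflection `s_α`. -/
def PosRoot.refl (m : ℕ) : PosRoot → Equiv.Perm (Fin (2*m+2))
  | .tm i j => Equiv.swap (fn m (i-1)) (fn m (j-1)) *
      Equiv.swap (fn m (2*m+2-i)) (fn m (2*m+2-j))
  | .tp i j => Equiv.swap (fn m (i-1)) (fn m (2*m+2-j)) *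
      Equiv.swap (fn m (j-1)) (fn m (2*m+2-i))
  | .lg i => Equiv.swap (fn m (i-1)) (fn m (2*m+2-i))

/-- The coefficient of the simple root `α_kk` in the expansion of `α` in simple roots. -/
def PosRoot.rootCoeff (m kk : ℕ) : PosRoot → ℕ
  | .tm i j => if i ≤ kk ∧ kk < j then 1 else 0
  | .tp i j => if i ≤ kk ∧ kk < j then 1 else if j ≤ kk ∧ kk ≤ m then 2
      else if j ≤ kk then 1 else 0
  | .lg i => if i ≤ kk ∧ kk ≤ m then 2 else if i ≤ kk then 1 else 0

/-- The coefficient of the simple coroot `α_kk^∨` in the expansion of `α^∨` in simple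
coroots: the degree of the corresponding edge of the moment graph. -/
def PosRoot.corootCoeff (kk : ℕ) : PosRoot → ℕ
  | .tm i j => if i ≤ kk ∧ kk < j then 1 else 0
  | .tp i j => if i ≤ kk ∧ kk < j then 1 else if j ≤ kk then 2 else 0
  | .lg i => if i ≤ kk then 1 else 0

/-- `α ∈ R_1^+`. -/
def PosRoot.inR1 (m kk : ℕ) : PosRoot → Bool
  | .tm i j => decide (1 ≤ i ∧ i ≤ kk ∧ kk < j ∧ j ≤ m+1)
  | .tp i j => decide (1 ≤ i ∧ i ≤ kk ∧ kk < j ∧ j ≤ m+1)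
  | .lg i => decide (1 ≤ i ∧ i ≤ kk)

/-- `α ∈ R_2^+`. -/
def PosRoot.inR2 (kk : ℕ) : PosRoot → Bool
  | .tp i j => decide (1 ≤ i ∧ i < j ∧ j ≤ kk)
  | _ => false

/-- Chains in the moment graph of `IG(kk, 2m+2)`, recorded with their list of roots:
each step goes from the vertex `u W_P` to the vertex with minimal length representative
`v`, where `v W_P = u s_α W_P` and `α ∈ R^+ \ R_P^+`. -/
inductive Chain (m kk : ℕ) :
    Equiv.Perm (Fin (2*m+2)) → Equiv.Perm (Fin (2*m+2)) → List PosRoot → Prop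
  | nil (u : Equiv.Perm (Fin (2*m+2))) : Chain m kk u u []
  | cons {u w : Equiv.Perm (Fin (2*m+2))} {l : List PosRoot}
      (a : PosRoot) (v : Equiv.Perm (Fin (2*m+2))) :
      a.valid m → a.rootCoeff m kk ≠ 0 → isMinRep m kk v →
      cosetEq m kk v (u * a.refl m) → Chain m kk v w l → Chain m kk u w (a :: l)

/-- The degree of a chain: the sum of the degrees of its edges. -/
def chainDeg (kk : ℕ) (l : List PosRoot) : ℕ := (l.map (PosRoot.corootCoeff kk)).sum

/-- Chains of a given total degree in the moment graph of `IG(kk, 2m+1)`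
(the full subgraph of the moment graph of `IG(kk, 2m+2)` on `W^P ∩ W^{odd}`). -/
inductive ChainO (m kk : ℕ) :
    Equiv.Perm (Fin (2*m+2)) → Equiv.Perm (Fin (2*m+2)) → ℕ → Prop
  | nil (u : Equiv.Perm (Fin (2*m+2))) : ChainO m kk u u 0
  | cons {u w : Equiv.Perm (Fin (2*m+2))} {d : ℕ}
      (a : PosRoot) (v : Equiv.Perm (Fin (2*m+2))) :
      a.valid m → a.rootCoeff m kk ≠ 0 → isMinRep m kk v → isOdd m v →
      cosetEq m kk v (u * a.refl m) → ChainO m kk v w d →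
      ChainO m kk u w (a.corootCoeff kk + d)

/-! ### The maps `Φ`, `Φ_Z`, `ψ` -/

/-- The relation `Φ(w W_P) = w' W_Y`, for `w` in the type `C_{n+1}` group and `w'` in the
type `C_n` group (entrywise shift of the first `kk` values). -/
def PhiRel (n kk : ℕ) (w : Equiv.Perm (Fin (2*n+2)))
    (w' : Equiv.Perm (Fin (2*(n-1)+2))) : Prop :=
  ∀ j, j < kk → ((w' (fn (n-1) j) : ℕ) + 1 = (w (fn n j) : ℕ))

/-- The relation `Φ_Z(w W_P) = w' W_Z` (entrywise shift of the values in positions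
`2, …, kk`). -/
def PhiZRel (n kk : ℕ) (w : Equiv.Perm (Fin (2*n+2)))
    (w' : Equiv.Perm (Fin (2*(n-1)+2))) : Prop :=
  ∀ j, j + 1 < kk → ((w' (fn (n-1) j) : ℕ) + 1 = (w (fn n (j+1)) : ℕ))

/-- The word `ψ(s_i)`. -/
def psiWord (kk i : ℕ) : List ℕ :=
  if i ≤ kk-1 then [i] else if i = kk then [kk, kk+1, kk] else [i+1]

/-- `j ↦ min({2,…,m+1} \ {|w(p)|, …, |w(kk)|})` (1-indexed positions `p ≤ j ≤ kk`). -/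
def jmin (m kk p : ℕ) (w : Equiv.Perm (Fin (2*m+2))) : ℕ :=
  sInf {i | 2 ≤ i ∧ i ≤ m+1 ∧ ∀ j, p ≤ j → j ≤ kk → absVal m (w (fn m (j-1))) ≠ i}

/-! ### Partitions -/

/-- `μ ∈ Part(k, N)`, encoded as a function `ℕ → ℤ` supported on `{1, …, k}`. -/
def IsPart (k N : ℕ) (μ : ℕ → ℤ) : Prop :=
  (∀ j, 1 ≤ j → j < k → μ (j+1) ≤ μ j) ∧ μ 1 ≤ (N:ℤ) - k ∧
  (∀ j, 1 ≤ j → j ≤ k → 0 ≤ μ j) ∧ (∀ j, j = 0 ∨ k < j → μ j = 0)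

/-- `D(μ)(i)`: the `i`-th step of the boundary path of the Young diagram of `μ` inside
the `k × (N-k)` rectangle (from northeast to southwest) is vertical. -/
def Dword (k N : ℕ) (μ : ℕ → ℤ) (i : ℕ) : Prop :=
  ∃ j, 1 ≤ j ∧ j ≤ k ∧ (i:ℤ) = (N:ℤ) - k - μ j + j

/-- `μ ∈ BC(k, 2n+2)`. -/
def IsBCeven (n k : ℕ) (μ : ℕ → ℤ) : Prop :=
  IsPart k (2*n+2) μ ∧
  ∀ i, 1 ≤ i → i ≤ n+1 → ¬(Dword k (2*n+2) μ i ∧ Dword k (2*n+2) μ (2*n+3-i))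

/-- `λ + 1^k`. -/
def addOne (k : ℕ) (lam : ℕ → ℤ) (j : ℕ) : ℤ := if 1 ≤ j ∧ j ≤ k then lam j + 1 else 0

/-- `λ ∈ BC(k, 2n+1)`: `λ ∈ Part(k, 2n+1)` and `λ + 1^k ∈ BC(k, 2n+2)`. -/
def IsBCodd (n k : ℕ) (lam : ℕ → ℤ) : Prop :=
  IsPart k (2*n+1) lam ∧ IsBCeven n k (addOne k lam)

/-- `β ∈ BKT(k, 2n+2)`: `(n+1-k)`-strict partitions. -/
def IsBKTeven (n k : ℕ) (β : ℕ → ℤ) : Prop :=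
  IsPart k (2*n+2) β ∧ ∀ j, 1 ≤ j → j < k → ((n:ℤ)+1-k < β j → β (j+1) < β j)

/-- `α ∈ BKT(k, 2n+1)`: `α = β - 1^k` with `β ∈ BKT(k, 2n+2)`. -/
def IsBKTodd (n k : ℕ) (α : ℕ → ℤ) : Prop :=
  IsBKTeven n k (addOne k α) ∧ (∀ j, j = 0 ∨ k < j → α j = 0)

/-- `ℓ(λ)`: the number of nonzero parts. -/
def numParts (k : ℕ) (lam : ℕ → ℤ) : ℕ :=
  ((Finset.Icc 1 k).filter (fun j => lam j ≠ 0)).card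

/-- `ℓ_i^d(λ) = #{j > d : λ_j > i}`. -/
def elld (k : ℕ) (lam : ℕ → ℤ) (i : ℤ) (d : ℕ) : ℕ :=
  ((Finset.Icc 1 k).filter (fun j => d < j ∧ i < lam j)).card

/-- `λ^{O∘(1)} = (λ_2-1, …, λ_{ℓ(λ)}-1, 0, …, 0)`. -/
def Oc1 (k : ℕ) (lam : ℕ → ℤ) (j : ℕ) : ℤ :=
  if 1 ≤ j ∧ j + 1 ≤ numParts k lam then lam (j+1) - 1 else 0

/-- `λ^{O∘(d)}`. -/
def OcD (k : ℕ) (lam : ℕ → ℤ) : ℕ → ℕ → ℤ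
  | 0 => lam
  | d+1 => Oc1 k (OcD k lam d)

/-- `λ^{O_Z(1)} = (λ_1, λ_3-1, …, λ_{ℓ(λ)}-1, 0, …, 0)` for `λ ∈ BC(k, 2n+1)`. -/
def OZ1 (k : ℕ) (lam : ℕ → ℤ) (j : ℕ) : ℤ :=
  if j = 1 then lam 1
  else if 2 ≤ j ∧ j + 1 ≤ numParts k lam then lam (j+1) - 1
  else 0

/-- `λ^{O_Z(d)}`. -/
def OZd (k : ℕ) (lam : ℕ → ℤ) : ℕ → ℕ → ℤ
  | 0 => lam
  | d+1 => OZ1 k (OZd k lam d)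

/-- `Comp_BC(d)`. -/
def CompBC (n k d : ℕ) (lam : ℕ → ℤ) : Prop :=
  IsBCodd n k lam ∧ lam 1 = 2*(n:ℤ)+1-k ∧
  lam (d+1) - (elld k lam ((d:ℤ)-1) (d+1) : ℤ) - d = 2*((n:ℤ)+1-k)

/-- The transposed partition. -/
def transpose (k : ℕ) (μ : ℕ → ℤ) (j : ℕ) : ℤ :=
  if 1 ≤ j then (((Finset.Icc 1 k).filter (fun i => (j:ℤ) ≤ μ i)).card : ℤ) else 0

/-- `D(μ)(i) = D(μ^t)(i)`. -/
def wingAgree (n k : ℕ) (μ : ℕ → ℤ) (i : ℕ) : Prop :=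
  Dword k (2*n+2) μ i ↔ Dword (2*n+2-k) (2*n+2) (transpose k μ) i

/-- `μ ∈ Part(k, 2n+2)` is `m`-wingtip symmetric. -/
def isWingtipEven (n k : ℕ) (μ : ℕ → ℤ) (m : ℕ) : Prop :=
  (∀ i, 1 ≤ i → i ≤ m → wingAgree n k μ i) ∧ (m = 2*n+2 ∨ ¬ wingAgree n k μ (m+1))

/-- `λ ∈ BC(k, 2n+1)` is `m`-wingtip symmetric. -/
def isWingtip (n k : ℕ) (lam : ℕ → ℤ) (m : ℕ) : Prop :=
  isWingtipEven n k (addOne k lam) m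

open scoped Classical in
/-- `λ^{O_Y(1)}` for an `m`-wingtip symmetric `λ ∈ BC(k, 2n+1)` with `λ_1 = 2n+1-k`. -/
def OY1 (n k m : ℕ) (lam : ℕ → ℤ) : ℕ → ℤ :=
  -- the step of `D(λ)` at position `bar m = 2n+3-m`
  let s := 2*n+3-m
  -- the row at (or just above) the step at position `s`
  let i := ((Finset.Icc 1 s).filter (fun t => Dword k (2*n+2) (addOne k lam) t)).card
  -- the column of the step at position `s` (when horizontal)
  let j := (2*n+2-k) + 1 -
    ((Finset.Icc 1 s).filter (fun t => ¬ Dword k (2*n+2) (addOne k lam) t)).card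
  if Dword k (2*n+2) (addOne k lam) s then
    -- `D(λ)(bar m) = 1` is the `i`-th 1: `(λ_2-1, …, λ_{i-1}-1, λ_i, λ_i, λ_{i+1}, …, λ_k)`
    fun p =>
      if 1 ≤ p ∧ p + 2 ≤ i then lam (p+1) - 1
      else if (p = i - 1 ∨ p = i) ∧ 1 ≤ p ∧ p ≤ k then lam i
      else if i + 1 ≤ p ∧ p ≤ k then lam p
      else 0
  else
    -- horizontal step at the bottom of row `i`, column `j`:
    -- `(λ_2-1, …, λ_i-1, j, λ_{i+1}, …, λ_k)`
    fun p =>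
      if 1 ≤ p ∧ p + 1 ≤ i then lam (p+1) - 1
      else if p = i ∧ 1 ≤ p ∧ p ≤ k then (j:ℤ)
      else if i + 1 ≤ p ∧ p ≤ k then lam p
      else 0

/-- `λ^{O_Y(d)} = (λ^{O_Y(1)})^{O∘(d-1)}`. -/
def OYd (n k m : ℕ) (lam : ℕ → ℤ) (d : ℕ) : ℕ → ℤ := OcD k (OY1 n k m lam) (d-1)

open scoped Classical in
/-- `α^{O_Z(1)}` for `α ∈ BKT(k, 2n+1)` with `α_1 = 2n+1-k`. -/
def OZ1bkt (n k : ℕ) (α : ℕ → ℤ) : ℕ → ℤ :=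
  if ∃ j, 3 ≤ j ∧ j ≤ k ∧ α 2 + α j ≤ 2*((n:ℤ)-k)+j-2 then
    -- `j0` minimal such that `α_2 + α_{j0} ≤ 2(n-k)+j0-2`
    let j0 := sInf {j | 3 ≤ j ∧ j ≤ k ∧ α 2 + α j ≤ 2*((n:ℤ)-k)+j-2}
    fun p =>
      if p = 1 then α 1
      else if 2 ≤ p ∧ p + 2 ≤ j0 then α (p+1)
      else if j0 ≤ p + 1 ∧ p + 1 ≤ k then max (α (p+1) - 1) (-1)
      else if p = k then -1 else 0
  else
    fun p =>
      if p = 1 then α 1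
      else if 2 ≤ p ∧ p + 1 ≤ k then α (p+1)
      else if p = k then -1 else 0

/-- `α^{O_Z(d)}`. -/
def OZdbkt (n k : ℕ) (α : ℕ → ℤ) : ℕ → ℕ → ℤ
  | 0 => α
  | d+1 => OZ1bkt n k (OZdbkt n k α d)

/-- `Comp_BKT(d)`. -/
def CompBKT (n k d : ℕ) (α : ℕ → ℤ) : Prop :=
  IsBKTodd n k α ∧ α 1 = 2*(n:ℤ)+1-k ∧
  (OZdbkt n k α (d-1)) 2 - (elld k (OZdbkt n k α (d-1)) (-1) 2 : ℤ) = 2*((n:ℤ)+1-k)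

/-- `ℓ_{-1}(α) = max {j : α_j > -1}`. -/
def ellNeg (k : ℕ) (α : ℕ → ℤ) : ℕ :=
  ((Finset.Icc 1 k).filter (fun j => (-1:ℤ) < α j)).sup id

/-- `α^{O_Y(1)} = (α_2, …, α_{ℓ_{-1}(α)}, 0, …, 0)` for `α ∈ BKT(k, 2n+1)` with
`α_1 = 2n+1-k`. -/
def OY1bkt (k : ℕ) (α : ℕ → ℤ) (j : ℕ) : ℤ :=
  if 1 ≤ j ∧ j + 1 ≤ ellNeg k α then α (j+1) else 0

/-! ### Correspondences between partitions and Weyl group elements -/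

/-- The 01-word correspondence between `μ ∈ BC(k, 2n+2)` and `w ∈ W^P`: for a 1-indexed
value `a ∈ {1, …, n+1}`, `a` occurs among the first `k` values of `w` iff `D(μ)(a) = 1`,
and `bar a` occurs iff `D(μ)(2n+3-a) = 1`. -/
def BCrel (n k : ℕ) (μ : ℕ → ℤ) (w : Equiv.Perm (Fin (2*n+2))) : Prop :=
  ∀ i, 1 ≤ i → i ≤ n+1 →
    ((fn n (i-1) ∈ valSet n k w) ↔ Dword k (2*n+2) μ i) ∧
    ((fn n (2*n+2-i) ∈ valSet n k w) ↔ Dword k (2*n+2) μ (2*n+3-i))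

/-- The BKT correspondence between `β ∈ BKT(k, 2n+2)` and `w ∈ W^P`:
`β_j = 2n+3-k-w(j) + #{i < j : w(i)+w(j) > 2n+3}` (1-indexed values). -/
def BKTrel (n k : ℕ) (β : ℕ → ℤ) (w : Equiv.Perm (Fin (2*n+2))) : Prop :=
  ∀ j, 1 ≤ j → j ≤ k →
    β j = 2*(n:ℤ)+3-k - ((w (fn n (j-1)) : ℕ) + 1) +
      (((Finset.Icc 1 (j-1)).filter
        (fun i => 2*n+1 < (w (fn n (i-1)) : ℕ) + (w (fn n (j-1)) : ℕ))).card : ℤ)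


theorem val_fn {m i : ℕ} (hi : i < 2 * m + 2) : (fn m i : ℕ) = i := Nat.mod_eq_of_lt hi

theorem swap_fn_apply {m a b : ℕ} (ha : a < 2 * m + 2) (hb : b < 2 * m + 2)
    {j : Fin (2 * m + 2)} (hja : (j : ℕ) ≠ a) (hjb : (j : ℕ) ≠ b) :
    Equiv.swap (fn m a) (fn m b) j = j := by
  refine Equiv.swap_apply_of_ne_of_ne ?_ ?_
  · rintro rfl
    exact hja (val_fn ha)
  · rintro rfl
    exact hjb (val_fn hb)

/-- A swap of two positions on the same side of the cut at `kk` preserves the sides. -/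
theorem swap_fn_apply_lt_iff {m a b kk : ℕ} (ha : a < 2 * m + 2) (hb : b < 2 * m + 2)
    (hab : a < kk ↔ b < kk) (j : Fin (2 * m + 2)) :
    (Equiv.swap (fn m a) (fn m b) j : ℕ) < kk ↔ (j : ℕ) < kk := by
  by_cases hja : j = fn m a
  · rw [hja, Equiv.swap_apply_left, val_fn ha, val_fn hb, hab]
  by_cases hjb : j = fn m b
  · rw [hjb, Equiv.swap_apply_right, val_fn ha, val_fn hb, hab]
  rw [Equiv.swap_apply_of_ne_of_ne hja hjb]

theorem sRefl_apply_lt_iff {m kk i : ℕ} (hkk : kk ≤ m + 1) (hi : 1 ≤ i) (him : i ≤ m + 1)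
    (hik : i ≠ kk) (j : Fin (2 * m + 2)) : (sRefl m i j : ℕ) < kk ↔ (j : ℕ) < kk := by
  unfold sRefl
  split_ifs with h
  · rw [Equiv.Perm.mul_apply, swap_fn_apply_lt_iff (by omega) (by omega) (by omega),
      swap_fn_apply_lt_iff (by omega) (by omega) (by omega)]
  · exact swap_fn_apply_lt_iff (by omega) (by omega) (by omega) j

/-- Elements of `W_P` permute the first `kk` positions among themselves. -/
theorem apply_lt_iff_of_mem_WP {m kk : ℕ} (hkk : kk ≤ m + 1) {u : Equiv.Perm (Fin (2 * m + 2))}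
    (hu : u ∈ WP m kk) (j : Fin (2 * m + 2)) : (u j : ℕ) < kk ↔ (j : ℕ) < kk := by
  induction hu using Subgroup.closure_induction generalizing j with
  | mem x hx =>
    obtain ⟨i, hi, him, hik, rfl⟩ := hx
    exact sRefl_apply_lt_iff hkk hi him hik j
  | one => rfl
  | mul x y _ _ hx hy => rw [Equiv.Perm.mul_apply, hx, hy]
  | inv x _ hx => rw [← hx, ← Equiv.Perm.mul_apply, mul_inv_cancel, Equiv.Perm.one_apply]

theorem phi_mul_of_mem_WP {m kk : ℕ} (hkk : kk ≤ m + 1) (w : Equiv.Perm (Fin (2 * m + 2)))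
    {u : Equiv.Perm (Fin (2 * m + 2))} (hu : u ∈ WP m kk) : phi m kk (w * u) = phi m kk w := by
  unfold phi
  refine Finset.card_equiv u fun j => ?_
  simp [apply_lt_iff_of_mem_WP hkk hu]

theorem phi_eq_of_cosetEq {m kk : ℕ} (hkk : kk ≤ m + 1) {x y : Equiv.Perm (Fin (2 * m + 2))}
    (h : cosetEq m kk x y) : phi m kk x = phi m kk y := by
  rw [← phi_mul_of_mem_WP hkk x h, mul_inv_cancel_left]

theorem phi_mul_le {m kk : ℕ} (v t : Equiv.Perm (Fin (2 * m + 2)))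
    (S : Finset (Fin (2 * m + 2)))
    (hS : ∀ j : Fin (2 * m + 2), (j : ℕ) < kk → j ∉ S → t j = j) :
    phi m kk (v * t) ≤ phi m kk v + S.card := by
  unfold phi
  refine (Finset.card_le_card ?_).trans (Finset.card_union_le _ _)
  intro j hj
  obtain ⟨hjk, hjv⟩ := (Finset.mem_filter.1 hj).2
  by_cases hjS : j ∈ S
  · exact Finset.mem_union_right _ hjS
  · rw [Equiv.Perm.mul_apply, hS j hjk hjS] at hjv
    exact Finset.mem_union_left _ (Finset.mem_filter.2 ⟨Finset.mem_univ j, hjk, hjv⟩)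

theorem ne_of_ne_fn {m i : ℕ} {j : Fin (2 * m + 2)} (h : j ≠ fn m i) : (j : ℕ) ≠ i := by
  rintro rfl
  exact h (Fin.ext (val_fn j.isLt).symm)

theorem phi_mul_refl_le_of_inR1 {m kk : ℕ} (hkk : kk ≤ m + 1) (v : Equiv.Perm (Fin (2 * m + 2)))
    {a : PosRoot} (ha : a.inR1 m kk = true) : phi m kk (v * a.refl m) ≤ phi m kk v + 1 := by
  cases a with
  | tm i l =>
    simp only [PosRoot.inR1, decide_eq_true_eq] at ha
    refine phi_mul_le v _ {fn m (i - 1)} fun j hj hjS => ?_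
    have := ne_of_ne_fn (Finset.notMem_singleton.1 hjS)
    rw [PosRoot.refl, Equiv.Perm.mul_apply,
      swap_fn_apply (j := j) (by omega) (by omega) (by omega) (by omega),
      swap_fn_apply (by omega) (by omega) (by omega) (by omega)]
  | tp i l =>
    simp only [PosRoot.inR1, decide_eq_true_eq] at ha
    refine phi_mul_le v _ {fn m (i - 1)} fun j hj hjS => ?_
    have := ne_of_ne_fn (Finset.notMem_singleton.1 hjS)
    rw [PosRoot.refl, Equiv.Perm.mul_apply,
      swap_fn_apply (j := j) (by omega) (by omega) (by omega) (by omega),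
      swap_fn_apply (by omega) (by omega) (by omega) (by omega)]
  | lg i =>
    simp only [PosRoot.inR1, decide_eq_true_eq] at ha
    refine phi_mul_le v _ {fn m (i - 1)} fun j hj hjS => ?_
    have := ne_of_ne_fn (Finset.notMem_singleton.1 hjS)
    exact swap_fn_apply (by omega) (by omega) (by omega) (by omega)

theorem phi_mul_refl_le_of_inR2 {m kk : ℕ} (hkk : kk ≤ m + 1) (v : Equiv.Perm (Fin (2 * m + 2)))
    {a : PosRoot} (ha : a.inR2 kk = true) : phi m kk (v * a.refl m) ≤ phi m kk v + 2 := by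
  cases a with
  | tp i l =>
    simp only [PosRoot.inR2, decide_eq_true_eq] at ha
    refine (phi_mul_le v _ {fn m (i - 1), fn m (l - 1)} fun j hj hjS => ?_).trans
      (Nat.add_le_add_left Finset.card_le_two _)
    simp only [Finset.mem_insert, Finset.mem_singleton, not_or] at hjS
    have hi := ne_of_ne_fn hjS.1
    have hl := ne_of_ne_fn hjS.2
    rw [PosRoot.refl, Equiv.Perm.mul_apply,
      swap_fn_apply (j := j) (by omega) (by omega) (by omega) (by omega),
      swap_fn_apply (by omega) (by omega) (by omega) (by omega)]
  | tm i l => simp [PosRoot.inR2] at ha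
  | lg i => simp [PosRoot.inR2] at ha

theorem corootCoeff_of_inR1 {m kk : ℕ} {a : PosRoot} (ha : a.inR1 m kk = true) :
    a.corootCoeff kk = 1 := by
  cases a <;> simp_all [PosRoot.inR1, PosRoot.corootCoeff]

theorem corootCoeff_of_inR2 {kk : ℕ} {a : PosRoot} (ha : a.inR2 kk = true) :
    a.corootCoeff kk = 2 := by
  cases a with
  | tp i l =>
    simp only [PosRoot.inR2, decide_eq_true_eq] at ha
    rw [PosRoot.corootCoeff, if_neg (by omega), if_pos ha.2.2]
  | tm i l => simp [PosRoot.inR2] at ha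
  | lg i => simp [PosRoot.inR2] at ha

/-- Properties of a single edge of the moment graph of `IG(k, 2n+2)`:
`w` is the minimal length representative of `v s_α W_P` for `α ∈ R^+ \ R_P^+`. -/
theorem statement0 (n k : ℕ) (hn : 1 ≤ n) (hk : 1 ≤ k) (hk' : k ≤ n+1)
    (v w : Equiv.Perm (Fin (2*n+2))) (a : PosRoot)
    (hv : isMinRep n k v) (hw : isMinRep n k w)
    (ha : a.valid n) (haP : a.rootCoeff n k ≠ 0)
    (hcoset : cosetEq n k w (v * a.refl n)) :
    (a.inR1 n k = true → a.corootCoeff k = 1) ∧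
    (a.inR2 k = true → a.corootCoeff k = 2) ∧
    (a.inR1 n k = true → phi n k w ≤ phi n k v + 1) ∧
    (a.inR2 k = true → phi n k w ≤ phi n k v + 2) := by
  rw [phi_eq_of_cosetEq hk' hcoset]
  exact ⟨corootCoeff_of_inR1, corootCoeff_of_inR2, phi_mul_refl_le_of_inR1 hk' v,
    phi_mul_refl_le_of_inR2 hk' v⟩

end
end OddSymplectic
end

section
/- Let u, v ∈ W^P be connected in the moment graph of IG(k,2n+2) by a chain of degree d whose edges are labeled by roots α_1, …, α_t ∈ R^+ ∖ R_P^+ (so vW_P = u s_{α_1} s_{α_2} ⋯ s_{α_t} W_P). Then: (1) d = #{i : α_i ∈ R_1^+} + 2·#{i : α_i ∈ R_2^+}; (2) φ(v) ≤ d + φ(u); (3) if u is the identity permutation, then at least k − d of the entries v(1), v(2), …, v(k) are less than or equal to k. -/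
/-!
Common framework: the Weyl group of type `C_{m+1}` realized as signed permutations
of `Fin (2*m+2)` (values 0-indexed: the paper's 1-indexed value `a ∈ {1, …, 2m+2}`
corresponds to `a-1`, and the paper's `bar a = 2m+3-a` corresponds to `2m+2-a`).
For the odd symplectic Grassmannian `IG(k, 2n+1)` one takes `m = n`;
the smaller group `W_{2n}` of type `C_n` corresponds to `m = n-1`.
-/

namespace OddSymplectic

open Equiv

noncomputable section

/-- The number of the first `k` positions at which `u` takes a value satisfying `S`. -/
def countVals (m k : ℕ) (S : Fin (2*m+2) → Prop) [DecidablePred S]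
    (u : Equiv.Perm (Fin (2*m+2))) : ℕ :=
  (Finset.univ.filter (fun j : Fin (2*m+2) => (j:ℕ) < k ∧ S (u j))).card

/-- The number of the first `k` positions that `σ` moves past position `k`. -/
def exits (m k : ℕ) (σ : Equiv.Perm (Fin (2*m+2))) : ℕ :=
  (Finset.univ.filter (fun j : Fin (2*m+2) => (j:ℕ) < k ∧ k ≤ (σ j : ℕ))).card

theorem countVals_mul_le (m k : ℕ) (S : Fin (2*m+2) → Prop) [DecidablePred S]
    (u σ : Equiv.Perm (Fin (2*m+2))) :
    countVals m k S (u * σ) ≤ exits m k σ + countVals m k S u := by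
  classical
  unfold countVals exits
  rw [← Finset.card_image_of_injective
    (Finset.univ.filter (fun j : Fin (2*m+2) => (j:ℕ) < k ∧ S (u j))) σ⁻¹.injective]
  refine (Finset.card_le_card ?_).trans (Finset.card_union_le _ _)
  intro j hj
  obtain ⟨-, hj, hS⟩ := Finset.mem_filter.1 hj
  rw [Finset.mem_union]
  by_cases h : k ≤ (σ j : ℕ)
  · exact Or.inl (Finset.mem_filter.2 ⟨Finset.mem_univ _, hj, h⟩)
  · exact Or.inr (Finset.mem_image.2
      ⟨σ j, Finset.mem_filter.2 ⟨Finset.mem_univ _, not_le.1 h, hS⟩, by simp⟩)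

theorem fn_val {m i : ℕ} (h : i < 2*m+2) : (fn m i : ℕ) = i := Nat.mod_eq_of_lt h

theorem swap_fn_val {m a b : ℕ} (ha : a < 2*m+2) (hb : b < 2*m+2) (x : Fin (2*m+2)) :
    (Equiv.swap (fn m a) (fn m b) x : ℕ) =
      if (x:ℕ) = a then b else if (x:ℕ) = b then a else (x:ℕ) := by
  rw [Equiv.swap_apply_def]
  simp only [Fin.ext_iff, fn_val ha, fn_val hb]
  split_ifs <;> simp [fn_val ha, fn_val hb]

theorem sRefl_lt_iff {m k i : ℕ} (hk : k ≤ m+1) (hi : 1 ≤ i) (hi' : i ≤ m+1) (hne : i ≠ k)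
    (x : Fin (2*m+2)) : (sRefl m i x : ℕ) < k ↔ (x:ℕ) < k := by
  have hx := x.isLt
  unfold sRefl
  split_ifs with h
  · rw [Equiv.Perm.mul_apply, swap_fn_val (by omega) (by omega),
      swap_fn_val (by omega) (by omega)]
    split_ifs <;> omega
  · rw [swap_fn_val (by omega) (by omega)]
    split_ifs <;> omega

theorem lt_iff_of_mem_WP {m k : ℕ} (hk : k ≤ m+1) {σ : Equiv.Perm (Fin (2*m+2))}
    (hσ : σ ∈ WP m k) : ∀ x, (σ x : ℕ) < k ↔ (x:ℕ) < k := by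
  induction hσ using Subgroup.closure_induction with
  | mem σ h =>
    obtain ⟨i, hi, hi', hne, rfl⟩ := h
    exact sRefl_lt_iff hk hi hi' hne
  | one => simp
  | mul σ τ _ _ hσ hτ => exact fun x => (hσ (τ x)).trans (hτ x)
  | inv σ _ hσ => exact fun x => by simpa using (hσ (σ⁻¹ x)).symm

theorem exits_eq_zero_of_mem_WP {m k : ℕ} (hk : k ≤ m+1) {σ : Equiv.Perm (Fin (2*m+2))}
    (hσ : σ ∈ WP m k) : exits m k σ = 0 := by
  rw [exits, Finset.card_eq_zero, Finset.filter_eq_empty_iff]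
  rintro x - ⟨h, h'⟩
  exact absurd ((lt_iff_of_mem_WP hk hσ x).2 h) (by omega)

theorem exits_le_of_forall {m k : ℕ} {σ : Equiv.Perm (Fin (2*m+2))} (T : Finset ℕ)
    (h : ∀ x : Fin (2*m+2), (x:ℕ) < k → k ≤ (σ x : ℕ) → (x:ℕ) ∈ T) :
    exits m k σ ≤ T.card := by
  refine Finset.card_le_card_of_injOn (fun x => (x:ℕ)) ?_ (fun _ _ _ _ h => Fin.ext h)
  intro x hx
  have hx' := (Finset.mem_filter.1 (Finset.mem_coe.1 hx)).2
  exact h x hx'.1 hx'.2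

theorem exits_refl_le {m k : ℕ} (hk : k ≤ m+1) (a : PosRoot) (ha : a.valid m) :
    exits m k (a.refl m) ≤ a.corootCoeff k := by
  cases a with
  | tm i j =>
    obtain ⟨hi, hij, hj⟩ := ha
    have key : ∀ x : Fin (2*m+2), (x:ℕ) < k → k ≤ ((PosRoot.tm i j).refl m x : ℕ) →
        (i ≤ k ∧ k < j) ∧ (x:ℕ) = i - 1 := by
      intro x hx h
      rw [PosRoot.refl, Equiv.Perm.mul_apply, swap_fn_val (by omega) (by omega),
        swap_fn_val (by omega) (by omega)] at h
      split_ifs at h <;> omega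
    simp only [PosRoot.corootCoeff]
    split_ifs with hc
    · exact exits_le_of_forall {i - 1} fun x hx h => by simpa using (key x hx h).2
    · exact exits_le_of_forall ∅ fun x hx h => absurd (key x hx h).1 hc
  | tp i j =>
    obtain ⟨hi, hij, hj⟩ := ha
    have key : ∀ x : Fin (2*m+2), (x:ℕ) < k → k ≤ ((PosRoot.tp i j).refl m x : ℕ) →
        (i ≤ k ∧ (x:ℕ) = i - 1) ∨ (j ≤ k ∧ (x:ℕ) = j - 1) := by
      intro x hx h
      rw [PosRoot.refl, Equiv.Perm.mul_apply, swap_fn_val (by omega) (by omega),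
        swap_fn_val (by omega) (by omega)] at h
      split_ifs at h <;> omega
    simp only [PosRoot.corootCoeff]
    split_ifs with hc hc'
    · refine exits_le_of_forall {i - 1} fun x hx h => ?_
      have := key x hx h
      simp only [Finset.mem_singleton]
      omega
    · refine (exits_le_of_forall {i - 1, j - 1} fun x hx h => ?_).trans Finset.card_le_two
      have := key x hx h
      simp only [Finset.mem_insert, Finset.mem_singleton]
      omega
    · refine exits_le_of_forall ∅ fun x hx h => ?_
      have := key x hx h
      omega
  | lg i =>
    obtain ⟨hi, hi'⟩ := ha
    have key : ∀ x : Fin (2*m+2), (x:ℕ) < k → k ≤ ((PosRoot.lg i).refl m x : ℕ) →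
        i ≤ k ∧ (x:ℕ) = i - 1 := by
      intro x hx h
      rw [PosRoot.refl, swap_fn_val (by omega) (by omega)] at h
      split_ifs at h <;> omega
    simp only [PosRoot.corootCoeff]
    split_ifs with hc
    · exact exits_le_of_forall {i - 1} fun x hx h => by simpa using (key x hx h).2
    · exact exits_le_of_forall ∅ fun x hx h => absurd (key x hx h).1 hc

theorem corootCoeff_eq {m k : ℕ} (a : PosRoot) (ha : a.valid m) :
    a.corootCoeff k = (if a.inR1 m k then 1 else 0) + 2 * (if a.inR2 k then 1 else 0) := by
  cases a <;> simp only [PosRoot.valid, PosRoot.corootCoeff, PosRoot.inR1, PosRoot.inR2,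
    decide_eq_true_eq] at ha ⊢ <;> split_ifs <;> first | rfl | omega | simp_all

theorem Chain.countVals_le {m k : ℕ} (hk : k ≤ m+1) (S : Fin (2*m+2) → Prop)
    [DecidablePred S] {u v : Equiv.Perm (Fin (2*m+2))} {l : List PosRoot}
    (hc : Chain m k u v l) : countVals m k S v ≤ chainDeg k l + countVals m k S u := by
  induction hc with
  | nil u => simp
  | @cons u w l a v ha _ _ hv _ ih =>
    have hp := inv_mem hv
    have h₁ := countVals_mul_le m k S (u * a.refl m) (v⁻¹ * (u * a.refl m))⁻¹
    rw [show u * a.refl m * (v⁻¹ * (u * a.refl m))⁻¹ = v by group,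
      exits_eq_zero_of_mem_WP hk hp] at h₁
    have h₂ := countVals_mul_le m k S u (a.refl m)
    have h₃ := exits_refl_le hk a ha
    have h₄ : chainDeg k (a :: l) = a.corootCoeff k + chainDeg k l := by simp [chainDeg]
    omega

theorem Chain.chainDeg_eq {m k : ℕ} {u v : Equiv.Perm (Fin (2*m+2))} {l : List PosRoot}
    (hc : Chain m k u v l) :
    chainDeg k l = l.countP (PosRoot.inR1 m k) + 2 * l.countP (PosRoot.inR2 k) := by
  induction hc with
  | nil u => simp [chainDeg]
  | @cons u w l a v ha _ _ _ _ ih =>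
    have h : chainDeg k (a :: l) = a.corootCoeff k + chainDeg k l := by simp [chainDeg]
    rw [h, ih, corootCoeff_eq a ha, List.countP_cons, List.countP_cons]
    ring

/-- Properties of a degree `d` chain in the moment graph of
`IG(k, 2n+2)` from `u W_P` to `v W_P` along the roots listed in `l`. -/
theorem statement1 (n k : ℕ) (hn : 1 ≤ n) (hk : 1 ≤ k) (hk' : k ≤ n+1)
    (u v : Equiv.Perm (Fin (2*n+2))) (hu : isMinRep n k u) (hv : isMinRep n k v)
    (l : List PosRoot) (hc : Chain n k u v l) :
    chainDeg k l = l.countP (PosRoot.inR1 n k) + 2 * l.countP (PosRoot.inR2 k) ∧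
    phi n k v ≤ chainDeg k l + phi n k u ∧
    (u = 1 → k ≤ chainDeg k l +
      (Finset.univ.filter (fun j : Fin (2*n+2) => (j:ℕ) < k ∧ (v j : ℕ) < k)).card) := by
  refine ⟨hc.chainDeg_eq, hc.countVals_le hk' (fun x => n + 1 ≤ (x:ℕ)), ?_⟩
  rintro rfl
  have h := hc.countVals_le hk' (fun x => k ≤ (x:ℕ))
  have h_one : countVals n k (fun x => k ≤ (x:ℕ)) 1 = 0 := by
    rw [countVals, Finset.card_eq_zero, Finset.filter_eq_empty_iff]
    rintro x - ⟨hx, hx'⟩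
    exact absurd hx' (by simpa using hx)
  have h_card : (Finset.univ.filter (fun j : Fin (2*n+2) => (j:ℕ) < k)).card = k := by
    rw [Fin.card_filter_val_lt]
    omega
  have h_split := Finset.card_filter_add_card_filter_not
    (s := Finset.univ.filter (fun j : Fin (2*n+2) => (j:ℕ) < k)) (fun j => (v j : ℕ) < k)
  simp only [Finset.filter_filter, not_lt, h_card] at h_split
  rw [h_one, countVals] at h
  omega

end
end OddSymplectic
end
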